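/- Let k be a nonnegative integer and let G be a connected graph whose diameter is at most D = 2k+1. Then the hyperbolicity of G is at most (D-1)/2 = k; equivalently, for every four vertices u,v,x,y, the two largest of the three sums d(u,v)+d(x,y), d(u,x)+d(v,y), d(u,y)+d(v,x) differ by at most 2k = D-1. -/

import Mathlib

open MeasureTheory Filter Real

noncomputable section

/-- The two largest of the three distance sums `d(u,v)+d(x,y)`, `d(u,x)+d(v,y)`,
`d(u,y)+d(v,x)` differ by at most `t`, for every four vertices. -/
def SlimTriples {V : Type*} (G : SimpleGraph V) (t : ℝ) : Prop :=
  ∀ u v x y : V,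
    ((G.dist u v + G.dist x y : ℕ) : ℝ) ≤
        max ((G.dist u x + G.dist v y : ℕ) : ℝ) ((G.dist u y + G.dist v x : ℕ) : ℝ) + t ∧
    ((G.dist u x + G.dist v y : ℕ) : ℝ) ≤
        max ((G.dist u v + G.dist x y : ℕ) : ℝ) ((G.dist u y + G.dist v x : ℕ) : ℝ) + t ∧
    ((G.dist u y + G.dist v x : ℕ) : ℝ) ≤
        max ((G.dist u v + G.dist x y : ℕ) : ℝ) ((G.dist u x + G.dist v y : ℕ) : ℝ) + t

/-- `G` is `δ`-hyperbolic. -/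
def IsDeltaHyperbolic {V : Type*} (G : SimpleGraph V) (δ : ℝ) : Prop :=
  SlimTriples G (2 * δ)

/-- The (Gromov) hyperbolicity of `G`: the smallest `δ ≥ 0` such that `G` is `δ`-hyperbolic. -/
def hyperbolicity {V : Type*} (G : SimpleGraph V) : ℝ :=
  sInf {δ : ℝ | 0 ≤ δ ∧ IsDeltaHyperbolic G δ}

end

/-- The four-point inequality over the naturals: triangle inequalities and parity. -/
theorem four_point_aux {V : Type*} (G : SimpleGraph V) (hG : G.Connected) (k : ℕ)
    (hdiam : ∀ u v : V, G.dist u v ≤ 2 * k + 1) (u v x y : V) :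
    G.dist u v + G.dist x y ≤
      max (G.dist u x + G.dist v y) (G.dist u y + G.dist v x) + 2 * k := by
  have h1 := hG.dist_triangle (u := u) (v := x) (w := v)
  have h2 := hG.dist_triangle (u := u) (v := y) (w := v)
  have h3 := hG.dist_triangle (u := x) (v := u) (w := y)
  have h4 := hG.dist_triangle (u := x) (v := v) (w := y)
  have h5 := hdiam u v
  have h6 := hdiam x y
  rw [G.dist_comm (u := x) (v := v)] at h1 h4
  rw [G.dist_comm (u := y) (v := v)] at h2
  rw [G.dist_comm (u := x) (v := u)] at h3
  omega

/-- If a connected graph has odd diameter at most `D = 2k+1`, then its hyperbolicity is at most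
`(D-1)/2 = k`; equivalently, for every four vertices the two largest of the three distance sums
differ by at most `2k = D - 1`. -/
theorem hyperbolicity_le_of_odd_diam {V : Type*} (G : SimpleGraph V) (hG : G.Connected) (k : ℕ)
    (hdiam : ∀ u v : V, G.dist u v ≤ 2 * k + 1) :
    hyperbolicity G ≤ (k : ℝ) ∧ SlimTriples G ((2 * k : ℕ) : ℝ) := by
  have hs : SlimTriples G ((2 * k : ℕ) : ℝ) := by
    intro u v x y
    have h1 := four_point_aux G hG k hdiam u v x y
    have h2 := four_point_aux G hG k hdiam u x v y
    have h3 := four_point_aux G hG k hdiam u y v x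
    rw [G.dist_comm (u := x) (v := v)] at h2
    rw [G.dist_comm (u := y) (v := x), G.dist_comm (u := y) (v := v)] at h3
    refine ⟨by exact_mod_cast h1, ?_, by exact_mod_cast h3⟩
    exact_mod_cast h2
  refine ⟨csInf_le ⟨0, fun δ hδ => hδ.1⟩ ⟨Nat.cast_nonneg k, ?_⟩, hs⟩
  have : (2 * (k : ℝ)) = ((2 * k : ℕ) : ℝ) := by push_cast; ring
  unfold IsDeltaHyperbolic
  rw [this]
  exact hs
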